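/- Theorem 1 (semi-Euclidean model): let E be a real inner product space, J : E →L[ℝ] E a symmetric linear involution, f : E → ℝ a differentiable transnormal function with continuous eikonal function a : ℝ → ℝ, and t₀ ∈ ℝ. Let F̂ : ℝ × ℝ × ℝ → ℝ be continuously differentiable and suppose (r₀, p₀) ∈ ℝ × (ℝ \ {0}) satisfy F̂(t₀, r₀, p₀) = 0, ∂F̂/∂p (t₀, r₀, p₀) ≠ 0 (derivative in the third variable), and a(t₀) · p₀ > 0. Then there exist ε > 0 and a continuously differentiable w : (t₀ − ε, t₀ + ε) → ℝ with w(t₀) = r₀ such that u := w ∘ f satisfies F̂(f x, u x, ⟪∇u(x), J(∇u(x))⟫) = 0 for every x in the open set Ω := f⁻¹((t₀ − ε, t₀ + ε)); in particular u is constant on each level set of f and f⁻¹({t₀}) ⊆ Ω. -/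

import Mathlib

open Real Set
open scoped RealInnerProductSpace

open scoped Topology NNReal

/-- Local existence of integral curves of a vector field which, near the initial point, is
continuous and uniformly Lipschitz in the space variable. -/
theorem exists_hasDerivAt_of_lipschitz_near
    {V : Type*} [NormedAddCommGroup V] [NormedSpace ℝ V] [CompleteSpace V]
    {v : ℝ → V → V} {t₀ : ℝ} {x₀ : V} {U : Set (ℝ × V)} {K : ℝ≥0} (hU : U ∈ 𝓝 (t₀, x₀))
    (hcont : ContinuousOn (Function.uncurry v) U)
    (hlip : ∀ t x y, (t, x) ∈ U → (t, y) ∈ U → dist (v t x) (v t y) ≤ K * dist x y) :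
    ∃ ε > 0, ∃ α : ℝ → V, α t₀ = x₀ ∧
      ∀ t ∈ Ioo (t₀ - ε) (t₀ + ε), (t, α t) ∈ U ∧ HasDerivAt α (v t (α t)) t := by
  set L : ℝ≥0 := ‖v t₀ x₀‖₊ + 1 with hL
  have hbound : ∀ᶠ z in 𝓝 (t₀, x₀), ‖Function.uncurry v z‖ < L :=
    (hcont.continuousAt hU).norm.eventually_lt_const (by simp [hL, Function.uncurry])
  obtain ⟨δ, hδ, hball⟩ := Metric.nhds_basis_closedBall.mem_iff.1 (Filter.inter_mem hU hbound)
  rw [← closedBall_prod_same] at hball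
  have hLpos : (0 : ℝ) < L := by positivity
  set η : ℝ := min δ (δ / L)
  have hη : 0 < η := lt_min hδ (by positivity)
  have hmem : ∀ t ∈ Icc (t₀ - η) (t₀ + η), ∀ x ∈ Metric.closedBall x₀ δ,
      (t, x) ∈ U ∧ ‖v t x‖ < L := fun t ht x hx ↦ hball ⟨by
    rw [← Real.closedBall_eq_Icc] at ht
    exact Metric.closedBall_subset_closedBall (min_le_left _ _) ht, hx⟩
  have hpl : IsPicardLindelof v (tmin := t₀ - η) (tmax := t₀ + η)
      ⟨t₀, by constructor <;> linarith⟩ x₀ ⟨δ, hδ.le⟩ 0 L K :=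
    { lipschitzOnWith := fun t ht ↦ LipschitzOnWith.of_dist_le_mul fun x hx y hy ↦
        hlip t x y (hmem t ht x hx).1 (hmem t ht y hy).1
      continuousOn := fun x hx ↦ hcont.comp (f := fun t ↦ (t, x)) (by fun_prop)
        fun t ht ↦ (hmem t ht x hx).1
      norm_le := fun t ht x hx ↦ (hmem t ht x hx).2.le
      mul_max_le := by
        have h : L * η ≤ δ := by
          calc (L : ℝ) * η ≤ L * (δ / L) := by gcongr; exact min_le_right _ _
            _ = δ := by field_simp
        simpa using! h }
  obtain ⟨α, hα₀, hα⟩ := hpl.exists_eq_forall_mem_Icc_hasDerivWithinAt₀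
  have hd : ∀ t ∈ Ioo (t₀ - η) (t₀ + η), HasDerivAt α (v t (α t)) t := fun t ht ↦
    (hα t (Ioo_subset_Icc_self ht)).hasDerivAt (Icc_mem_nhds ht.1 ht.2)
  have hα₀ : α t₀ = x₀ := hα₀
  have hcurve : ContinuousAt (fun t ↦ (t, α t)) t₀ :=
    continuousAt_id.prodMk (hd t₀ ⟨by linarith, by linarith⟩).continuousAt
  have hstay : ∀ᶠ t in 𝓝 t₀, (t, α t) ∈ U := hcurve (by simpa [hα₀] using hU)
  obtain ⟨ε, hε, hεU⟩ := Metric.eventually_nhds_iff_ball.1 hstay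
  refine ⟨min ε η, lt_min hε hη, α, hα₀, fun t ht ↦ ?_⟩
  rw [← Real.ball_eq_Ioo] at ht
  refine ⟨hεU t (Metric.ball_subset_ball (min_le_left _ _) ht), hd t ?_⟩
  rw [← Real.ball_eq_Ioo]
  exact Metric.ball_subset_ball (min_le_right _ _) ht

/-- Scalar form of the implicit function theorem: `F (t, r, p) = 0` is solved for `p` near a point
where `∂F/∂p` does not vanish. -/
theorem exists_contDiffAt_implicit_third {F : ℝ × ℝ × ℝ → ℝ} (hF : ContDiff ℝ 1 F)
    {t₀ r₀ p₀ : ℝ} (hF0 : F (t₀, r₀, p₀) = 0)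
    (hFp : deriv (fun p => F (t₀, r₀, p)) p₀ ≠ 0) :
    ∃ g : ℝ × ℝ → ℝ, g (t₀, r₀) = p₀ ∧ ContDiffAt ℝ 1 g (t₀, r₀) ∧
      ∀ᶠ z in 𝓝 (t₀, r₀), F (z.1, z.2, g z) = 0 := by
  set G : (ℝ × ℝ) × ℝ → ℝ := fun q ↦ F (q.1.1, q.1.2, q.2)
  have hGc : ContDiff ℝ 1 G := by fun_prop
  have cdf : ContDiffAt ℝ 1 G ((t₀, r₀), p₀) := hGc.contDiffAt
  have hd : HasDerivAt (fun p ↦ F (t₀, r₀, p))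
      (fderiv ℝ G ((t₀, r₀), p₀) ((0, 0), 1)) p₀ :=
    (cdf.differentiableAt one_ne_zero).hasFDerivAt.comp_hasDerivAt p₀
      (f := fun p : ℝ ↦ ((t₀, r₀), p))
      ((hasDerivAt_const p₀ (t₀, r₀)).prodMk (hasDerivAt_id p₀))
  rw [hd.deriv] at hFp
  have hinv : (fderiv ℝ G ((t₀, r₀), p₀) ∘L .inr ℝ (ℝ × ℝ) ℝ).IsInvertible := by
    refine ⟨ContinuousLinearEquiv.unitsEquivAut ℝ (Units.mk0 _ hFp), ?_⟩
    ext
    simp [← Prod.zero_eq_mk]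
  exact ⟨cdf.implicitFunction one_ne_zero hinv, cdf.implicitFunction_apply_self one_ne_zero hinv,
    cdf.contDiffAt_implicitFunction one_ne_zero hinv, by
      filter_upwards [cdf.eventually_apply_implicitFunction one_ne_zero hinv] with z hz
      exact hz.trans hF0⟩

/-- Local existence of `C¹` solutions of `F (t, w, a(t) w'²) = 0`. -/
theorem exists_hasDerivAt_implicit_sq
    {a : ℝ → ℝ} (ha : Continuous a) {F : ℝ × ℝ × ℝ → ℝ} (hF : ContDiff ℝ 1 F)
    {t₀ r₀ p₀ : ℝ} (hF0 : F (t₀, r₀, p₀) = 0)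
    (hFp : deriv (fun p => F (t₀, r₀, p)) p₀ ≠ 0) (hap : a t₀ * p₀ > 0) :
    ∃ ε > 0, ∃ w w' : ℝ → ℝ, w t₀ = r₀ ∧ ContinuousOn w' (Ioo (t₀ - ε) (t₀ + ε)) ∧
      ∀ t ∈ Ioo (t₀ - ε) (t₀ + ε), HasDerivAt w (w' t) t ∧ F (t, w t, w' t ^ 2 * a t) = 0 := by
  obtain ⟨g, hg₀, hg, hFg⟩ := exists_contDiffAt_implicit_third hF hF0 hFp
  have hp₀ : p₀ ≠ 0 := right_ne_zero_of_mul hap.ne'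
  have hpos : 0 < p₀ * g (t₀, r₀) := by rw [hg₀]; exact mul_self_pos.2 hp₀
  have hΦ : ContDiffAt ℝ 1 (fun z ↦ √(p₀ * g z)) (t₀, r₀) :=
    (contDiffAt_const.mul hg).sqrt hpos.ne'
  obtain ⟨K, S, hS, hlip⟩ := hΦ.exists_lipschitzOnWith
  set c : ℝ → ℝ := fun t ↦ (√(a t * p₀))⁻¹ with hc
  have hcc : ∀ t, 0 < a t * p₀ → ContinuousAt c t := fun t ht ↦
    ContinuousAt.inv₀ (by fun_prop) (Real.sqrt_pos.2 ht).ne'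
  set M : ℝ≥0 := ‖c t₀‖₊ + 1 with hM
  have hfst : Filter.Tendsto Prod.fst (𝓝 (t₀, r₀)) (𝓝 t₀) := continuousAt_fst
  have hcM : ∀ᶠ z in 𝓝 (t₀, r₀), ‖c z.1‖ < M :=
    hfst.eventually ((hcc t₀ hap).norm.eventually_lt_const (by simp [hM]))
  have hapos : ∀ᶠ z : ℝ × ℝ in 𝓝 (t₀, r₀), 0 < a z.1 * p₀ :=
    hfst.eventually ((by fun_prop : ContinuousAt (fun t ↦ a t * p₀) t₀).eventually_const_lt hap)
  have hgpos : ∀ᶠ z in 𝓝 (t₀, r₀), 0 < p₀ * g z :=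
    (continuousAt_const.mul hg.continuousAt).eventually_const_lt hpos
  set v : ℝ → ℝ → ℝ := fun t r ↦ c t * √(p₀ * g (t, r)) with hv
  set U : Set (ℝ × ℝ) := {z | z ∈ S ∧ ‖c z.1‖ < M ∧ 0 < a z.1 * p₀ ∧ 0 < p₀ * g z ∧
    F (z.1, z.2, g z) = 0}
  have hUn : U ∈ 𝓝 (t₀, r₀) := by
    filter_upwards [hS, hcM, hapos, hgpos, hFg] with z h1 h2 h3 h4 h5
    exact ⟨h1, h2, h3, h4, h5⟩
  have hvc : ContinuousOn (Function.uncurry v) U := by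
    refine ContinuousOn.mul (f := fun z : ℝ × ℝ ↦ c z.1) (g := fun z ↦ √(p₀ * g z))
      (fun z hz ↦ ?_) (hlip.continuousOn.mono fun z hz ↦ hz.1)
    exact ((hcc z.1 hz.2.2.1).comp (f := Prod.fst) continuousAt_fst).continuousWithinAt
  have hvl : ∀ t x y, (t, x) ∈ U → (t, y) ∈ U →
      dist (v t x) (v t y) ≤ (M * K : ℝ≥0) * dist x y := by
    intro t x y hx hy
    have h := hlip.dist_le_mul _ hx.1 _ hy.1
    have hxy : dist (t, x) (t, y) = dist x y := by simp [Prod.dist_eq]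
    rw [hxy] at h
    rw [Real.dist_eq] at h ⊢
    simp only [hv]
    rw [← mul_sub, abs_mul, NNReal.coe_mul, mul_assoc]
    exact mul_le_mul hx.2.1.le h (abs_nonneg _) M.2
  obtain ⟨ε, hε, w, hw₀, hw⟩ := exists_hasDerivAt_of_lipschitz_near hUn hvc hvl
  refine ⟨ε, hε, w, fun t ↦ v t (w t), hw₀, ?_, fun t ht ↦ ⟨(hw t ht).2, ?_⟩⟩
  · refine hvc.comp (f := fun t ↦ (t, w t)) (fun t ht ↦ ?_) fun t ht ↦ (hw t ht).1
    exact (continuousAt_id.prodMk (hw t ht).2.continuousAt).continuousWithinAt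
  · obtain ⟨-, -, h3, h4, h5⟩ := (hw t ht).1
    have ha0 : a t ≠ 0 := left_ne_zero_of_mul h3.ne'
    have key : v t (w t) ^ 2 * a t = g (t, w t) := by
      simp only [hv, hc]
      rw [mul_pow, inv_pow, Real.sq_sqrt h3.le, Real.sq_sqrt h4.le]
      field_simp
    rw [key]
    exact h5

/-- Chain rule for the gradient of `w ∘ f` with `w` a function of one real variable. -/
theorem HasDerivAt.comp_hasGradientAt {E : Type*} [NormedAddCommGroup E] [InnerProductSpace ℝ E]
    [CompleteSpace E] {f : E → ℝ} {f' x : E} {w : ℝ → ℝ} {w' : ℝ}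
    (hw : HasDerivAt w w' (f x)) (hf : HasGradientAt f f' x) :
    HasGradientAt (w ∘ f) (w' • f') x := by
  rw [hasGradientAt_iff_hasFDerivAt] at hf ⊢
  simpa using hw.comp_hasFDerivAt x hf

/-- Theorem 1 (semi-Euclidean model): local existence of an `f`-invariant solution
`u = w ∘ f` to `F̂(f x, u x, ⟪∇u, J ∇u⟫) = 0` on the `f`-invariant neighborhood
`Ω = f⁻¹((t₀ - ε, t₀ + ε))` of the level set `f⁻¹({t₀})`. -/
theorem semiEuclidean_local_existence
    {E : Type*} [NormedAddCommGroup E] [InnerProductSpace ℝ E] [CompleteSpace E]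
    (J : E →L[ℝ] E) (hJsymm : ∀ x y : E, ⟪J x, y⟫ = ⟪x, J y⟫)
    (hJinv : ∀ x : E, J (J x) = x)
    (f : E → ℝ) (hf : Differentiable ℝ f)
    (a : ℝ → ℝ) (ha : Continuous a)
    (hfa : ∀ x : E, ⟪gradient f x, J (gradient f x)⟫ = a (f x))
    (t₀ : ℝ)
    (F : ℝ × ℝ × ℝ → ℝ) (hF : ContDiff ℝ 1 F)
    (r₀ p₀ : ℝ) (hp₀ : p₀ ≠ 0)
    (hF0 : F (t₀, r₀, p₀) = 0)
    (hFp : deriv (fun p => F (t₀, r₀, p)) p₀ ≠ 0)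
    (hap : a t₀ * p₀ > 0) :
    ∃ ε > 0, ∃ w : ℝ → ℝ, w t₀ = r₀ ∧
      ContDiffOn ℝ 1 w (Set.Ioo (t₀ - ε) (t₀ + ε)) ∧
      (∀ x ∈ f ⁻¹' Set.Ioo (t₀ - ε) (t₀ + ε),
        F (f x, (w ∘ f) x,
            ⟪gradient (w ∘ f) x, J (gradient (w ∘ f) x)⟫) = 0) ∧
      (∀ x y : E, f x = f y → (w ∘ f) x = (w ∘ f) y) ∧
      f ⁻¹' {t₀} ⊆ f ⁻¹' Set.Ioo (t₀ - ε) (t₀ + ε) := by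
  obtain ⟨ε, hε, w, w', hw₀, hw'c, hw⟩ := exists_hasDerivAt_implicit_sq ha hF hF0 hFp hap
  refine ⟨ε, hε, w, hw₀, ?_, fun x hx ↦ ?_, fun x y h ↦ congrArg w h, ?_⟩
  · rw [← zero_add (1 : WithTop ℕ∞), contDiffOn_succ_iff_deriv_of_isOpen isOpen_Ioo]
    refine ⟨fun t ht ↦ (hw t ht).1.differentiableAt.differentiableWithinAt, by simp, ?_⟩
    exact contDiffOn_zero.2 (hw'c.congr fun t ht ↦ (hw t ht).1.deriv)
  · obtain ⟨hd, hFx⟩ := hw (f x) hx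
    rw [(hd.comp_hasGradientAt (hf x).hasGradientAt).gradient, map_smul, real_inner_smul_left,
      real_inner_smul_right, hfa, ← mul_assoc, ← sq]
    exact hFx
  · rintro x rfl
    constructor <;> linarith
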